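/- arXiv:1006.3514 — 2 statements merged into one kernel-verified Lean document; each statement's English description precedes it below -/
import Mathlib

section
/- Let d ≥ 1, let c ≥ 1, and let δ ≥ 2c. For all points s, q ∈ ℝ^d with ‖s − q‖ ≤ 1, the probability over (a, b) that the ternary hash indices of s and q mismatch satisfies Ψ̄(s, q) ≤ (1/(δ³√(2π))) · e^{−δ²/2}; equivalently, the probability that the ternary hashes of s and q match is at least p₁(δ) := 1 − (1/(δ³√(2π))) e^{−δ²/2}. (This is the first half of the statement that the family G_δ is a (1, c, p₁(δ), p₂(δ/c))-TLSH family.) -/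
open MeasureTheory ProbabilityTheory Real
open scoped ENNReal

noncomputable section

/-- Standard inner product on `Fin d → ℝ`. -/
def dotp {d : ℕ} (a x : Fin d → ℝ) : ℝ := ∑ i, a i * x i

/-- Euclidean norm on `Fin d → ℝ`. -/
def enorm' {d : ℕ} (x : Fin d → ℝ) : ℝ := Real.sqrt (∑ i, x i ^ 2)

/-- Ternary hash index `⌊(⟨a,p⟩ + b)/δ⌋ mod 4`. -/
def hashIdx {d : ℕ} (δ : ℝ) (a : Fin d → ℝ) (b : ℝ) (p : Fin d → ℝ) : ℤ :=
  ⌊(dotp a p + b) / δ⌋ % 4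

/-- `s` and `q` mismatch: one hash index is 0 (ternary symbol `0`) and the other is 2
(ternary symbol `1`). -/
def Mismatch {d : ℕ} (δ : ℝ) (a : Fin d → ℝ) (b : ℝ) (s q : Fin d → ℝ) : Prop :=
  (hashIdx δ a b s = 0 ∧ hashIdx δ a b q = 2) ∨ (hashIdx δ a b s = 2 ∧ hashIdx δ a b q = 0)

/-- Product of `d` i.i.d. standard Gaussians: the law of `a`. -/
def gaussPi (d : ℕ) : Measure (Fin d → ℝ) := Measure.pi fun _ => gaussianReal 0 1

/-- Uniform probability measure on the interval `(0, 2δ)`: the law of `b`. -/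
def unifB (δ : ℝ) : Measure ℝ :=
  (ENNReal.ofReal (2 * δ))⁻¹ • volume.restrict (Set.Ioo 0 (2 * δ))

/-- Joint law of the independent pair `(a, b)`. -/
def jointμ (d : ℕ) (δ : ℝ) : Measure ((Fin d → ℝ) × ℝ) := (gaussPi d).prod (unifB δ)

/-- Mismatch probability `Ψ̄(s,q)` over the random pair `(a, b)`. -/
def PsiBar (d : ℕ) (δ : ℝ) (s q : Fin d → ℝ) : ℝ≥0∞ :=
  jointμ d δ {ab : (Fin d → ℝ) × ℝ | Mismatch δ ab.1 ab.2 s q}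

/-- Complementary cdf `F̄` of the standard normal distribution. -/
def Fbar (y : ℝ) : ℝ := ∫ t in Set.Ioi y, (1 / Real.sqrt (2 * π)) * Real.exp (-t ^ 2 / 2)

/-- The function `φ(y) = e^{-y²/2}/(y√(2π)) - F̄(y)`. -/
def phi (y : ℝ) : ℝ := Real.exp (-y ^ 2 / 2) / (y * Real.sqrt (2 * π)) - Fbar y

/-- One-dimensional ternary hash index `⌊(u + b)/δ⌋ mod 4`. -/
def jb (δ b u : ℝ) : ℤ := ⌊(u + b) / δ⌋ % 4

/-- One-dimensional mismatch: one index is 0 and the other is 2. -/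
def Mismatch1 (δ b u v : ℝ) : Prop :=
  (jb δ b u = 0 ∧ jb δ b v = 2) ∨ (jb δ b u = 2 ∧ jb δ b v = 0)

/-- One-dimensional mismatch probability `ψ̄(u,v)` over `b` uniform on `(0, 2δ)`. -/
def psiBar (δ u v : ℝ) : ℝ≥0∞ := unifB δ {b | Mismatch1 δ b u v}

theorem Mismatch1.symm {δ b u v : ℝ} (h : Mismatch1 δ b u v) : Mismatch1 δ b v u :=
  h.elim (fun h => Or.inr ⟨h.2, h.1⟩) fun h => Or.inl ⟨h.2, h.1⟩

theorem measurableSet_setOf_mismatch {d : ℕ} (δ : ℝ) (s q : Fin d → ℝ) :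
    MeasurableSet {ab : (Fin d → ℝ) × ℝ | Mismatch δ ab.1 ab.2 s q} := by
  have hm (p : Fin d → ℝ) :
      Measurable fun ab : (Fin d → ℝ) × ℝ => hashIdx δ ab.1 ab.2 p := by
    have hfloor : Measurable fun ab : (Fin d → ℝ) × ℝ => ⌊(dotp ab.1 p + ab.2) / δ⌋ := by
      unfold dotp
      fun_prop
    exact (measurable_of_countable fun n : ℤ => n % 4).comp hfloor
  have hk (p : Fin d → ℝ) (k : ℤ) :
      MeasurableSet {ab : (Fin d → ℝ) × ℝ | hashIdx δ ab.1 ab.2 p = k} :=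
    hm p (measurableSet_singleton k)
  exact (((hk s 0).inter (hk q 2)).union ((hk s 2).inter (hk q 0)))

theorem measurableSet_setOf_mismatch1 (δ u v : ℝ) : MeasurableSet {b | Mismatch1 δ b u v} := by
  have hm (p : ℝ) : Measurable fun b : ℝ => jb δ b p := by
    have hfloor : Measurable fun b : ℝ => ⌊(p + b) / δ⌋ := by fun_prop
    exact (measurable_of_countable fun n : ℤ => n % 4).comp hfloor
  have hk (p : ℝ) (k : ℤ) : MeasurableSet {b : ℝ | jb δ b p = k} :=
    hm p (measurableSet_singleton k)
  exact (((hk u 0).inter (hk v 2)).union ((hk u 2).inter (hk v 0)))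

theorem mismatch1_add_zsmul_iff {δ : ℝ} (hδ : δ ≠ 0) (n : ℤ) (b u v : ℝ) :
    Mismatch1 δ (n • (2 * δ) + b) u v ↔ Mismatch1 δ b u v := by
  have hjb (p : ℝ) : jb δ (n • (2 * δ) + b) p = (⌊(p + b) / δ⌋ + 2 * n) % 4 := by
    have : (p + (n • (2 * δ) + b)) / δ = (p + b) / δ + ((2 * n : ℤ) : ℝ) := by
      push_cast
      rw [zsmul_eq_mul]
      field_simp
      ring
    rw [jb, this, Int.floor_add_intCast]
  simp only [Mismatch1, hjb]
  simp only [jb]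
  omega

theorem volume_setOf_mismatch1_inter_Ioc {δ : ℝ} (hδ : 0 < δ) (u v t : ℝ) :
    volume ({b | Mismatch1 δ b u v} ∩ Set.Ioc t (t + 2 * δ)) =
      volume ({b | Mismatch1 δ b u v} ∩ Set.Ioc 0 (0 + 2 * δ)) := by
  have hT : 0 < 2 * δ := by positivity
  refine (isAddFundamentalDomain_Ioc hT t).measure_set_eq (isAddFundamentalDomain_Ioc hT 0)
    (measurableSet_setOf_mismatch1 δ u v) ?_
  rintro ⟨_, n, rfl⟩
  ext b
  exact mismatch1_add_zsmul_iff hδ.ne' n b u v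

theorem volume_setOf_mismatch1_inter_Ioo_le_of_le {δ u v : ℝ} (hδ : 0 < δ) (huv : u ≤ v) :
    volume ({b | Mismatch1 δ b u v} ∩ Set.Ioo 0 (2 * δ)) ≤ ENNReal.ofReal (v - u - δ) := by
  have hsub : {b | Mismatch1 δ b u v} ∩ Set.Ioc (-u) (-u + 2 * δ) ⊆
      insert (-u + 2 * δ) (Set.Ico (2 * δ - v) (δ - u)) := by
    rintro b ⟨hb, hb1, hb2⟩
    rcases hb2.eq_or_lt with hb2 | hb2
    · exact Or.inl hb2
    right
    have h0 : 0 ≤ ⌊(u + b) / δ⌋ := Int.floor_nonneg.2 (div_nonneg (by linarith) hδ.le)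
    have h2 : ⌊(u + b) / δ⌋ < 2 := by
      rw [Int.floor_lt, div_lt_iff₀ hδ]
      push_cast
      linarith
    have hle : ⌊(u + b) / δ⌋ ≤ ⌊(v + b) / δ⌋ := Int.floor_mono (by gcongr)
    have hb' : ⌊(u + b) / δ⌋ < 1 ∧ 2 ≤ ⌊(v + b) / δ⌋ := by
      simp only [Set.mem_ofPred_eq, Mismatch1, jb] at hb
      omega
    obtain ⟨h3, h4⟩ := hb'
    rw [Int.floor_lt, div_lt_iff₀ hδ] at h3
    rw [Int.le_floor, le_div_iff₀ hδ] at h4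
    push_cast at h3 h4
    constructor <;> linarith
  calc volume ({b | Mismatch1 δ b u v} ∩ Set.Ioo 0 (2 * δ))
      ≤ volume ({b | Mismatch1 δ b u v} ∩ Set.Ioc 0 (0 + 2 * δ)) := by
        rw [zero_add]
        exact measure_mono (Set.inter_subset_inter_right _ Set.Ioo_subset_Ioc_self)
    _ = volume ({b | Mismatch1 δ b u v} ∩ Set.Ioc (-u) (-u + 2 * δ)) :=
        (volume_setOf_mismatch1_inter_Ioc hδ u v (-u)).symm
    _ ≤ volume (insert (-u + 2 * δ) (Set.Ico (2 * δ - v) (δ - u))) := measure_mono hsub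
    _ = ENNReal.ofReal (v - u - δ) := by
        rw [measure_congr (insert_ae_eq_self _ _), Real.volume_Ico]
        congr 1
        ring

theorem volume_setOf_mismatch1_inter_Ioo_le {δ : ℝ} (hδ : 0 < δ) (u v : ℝ) :
    volume ({b | Mismatch1 δ b u v} ∩ Set.Ioo 0 (2 * δ)) ≤ ENNReal.ofReal (|u - v| - δ) := by
  rcases le_total u v with huv | huv
  · rw [abs_sub_comm, abs_of_nonneg (sub_nonneg.2 huv)]
    exact volume_setOf_mismatch1_inter_Ioo_le_of_le hδ huv
  · rw [abs_of_nonneg (sub_nonneg.2 huv)]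
    have hsymm : {b | Mismatch1 δ b u v} = {b | Mismatch1 δ b v u} :=
      Set.ext fun _ => ⟨Mismatch1.symm, Mismatch1.symm⟩
    rw [hsymm]
    exact volume_setOf_mismatch1_inter_Ioo_le_of_le hδ huv

theorem psiBar_le {δ : ℝ} (hδ : 0 < δ) (u v : ℝ) :
    psiBar δ u v ≤ (ENNReal.ofReal (2 * δ))⁻¹ * ENNReal.ofReal (|u - v| - δ) := by
  rw [psiBar, unifB, Measure.smul_apply, smul_eq_mul,
    Measure.restrict_apply (measurableSet_setOf_mismatch1 δ u v)]
  gcongr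
  exact volume_setOf_mismatch1_inter_Ioo_le hδ u v

theorem measurable_dotp_left {d : ℕ} (w : Fin d → ℝ) : Measurable fun a => dotp a w := by
  unfold dotp
  fun_prop

theorem enorm'_nonneg {d : ℕ} (w : Fin d → ℝ) : 0 ≤ enorm' w :=
  Real.sqrt_nonneg _

theorem enorm'_sq {d : ℕ} (w : Fin d → ℝ) : enorm' w ^ 2 = ∑ i, w i ^ 2 :=
  Real.sq_sqrt (Finset.sum_nonneg fun i _ => sq_nonneg (w i))

/-- A linear functional of a standard Gaussian vector is a scaled standard Gaussian. -/
theorem gaussPi_map_dotp {d : ℕ} (w : Fin d → ℝ) :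
    (gaussPi d).map (fun a => dotp a w) = (gaussianReal 0 1).map (fun x => enorm' w * x) := by
  have : IsProbabilityMeasure (gaussPi d) := by
    unfold gaussPi
    infer_instance
  have : IsProbabilityMeasure ((gaussPi d).map fun a => dotp a w) :=
    Measure.isProbabilityMeasure_map (measurable_dotp_left w).aemeasurable
  rw [gaussianReal_map_const_mul]
  refine Measure.ext_of_charFun (funext fun t => ?_)
  have hpi := charFun_pi (μ := fun _ : Fin d => gaussianReal 0 1) (WithLp.toLp 2 (t • w))
  rw [charFun_apply, integral_map (by fun_prop) (by fun_prop)] at hpi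
  rw [charFun_apply, integral_map (measurable_dotp_left w).aemeasurable (by fun_prop)]
  simp only [charFun_gaussianReal, PiLp.inner_apply, Pi.smul_apply, smul_eq_mul,
    RCLike.inner_apply, conj_trivial] at hpi ⊢
  have hexp (a : Fin d → ℝ) : ∑ i, t * w i * a i = t * dotp a w := by
    rw [dotp, Finset.mul_sum]
    exact Finset.sum_congr rfl fun i _ => by ring
  simp only [hexp] at hpi
  rw [gaussPi, hpi, ← Complex.exp_sum]
  congr 1
  have hsq : ((enorm' w : ℂ)) ^ 2 = ∑ i, (w i : ℂ) ^ 2 := by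
    exact_mod_cast enorm'_sq w
  push_cast
  simp [hsq, ← Finset.sum_div, ← Finset.mul_sum, mul_pow, mul_comm]

/-- The expected excess of a standard Gaussian over `δ`. -/
theorem lintegral_ofReal_sub_gaussianReal_le {δ : ℝ} (hδ : 0 < δ) :
    ∫⁻ x, ENNReal.ofReal (x - δ) ∂(gaussianReal 0 1) ≤
      ENNReal.ofReal (1 / (δ ^ 2 * √(2 * π)) * rexp (-δ ^ 2 / 2)) := by
  rw [gaussianReal_of_var_ne_zero _ one_ne_zero,
    lintegral_withDensity_eq_lintegral_mul _ (measurable_gaussianPDF 0 1) (by fun_prop)]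
  set C := 1 / (δ ^ 2 * √(2 * π)) * rexp (-δ ^ 2 / 2) with hC
  have hC0 : 0 ≤ C := by positivity
  calc ∫⁻ x, (gaussianPDF 0 1 * fun x => ENNReal.ofReal (x - δ)) x
      ≤ ∫⁻ x, ENNReal.ofReal C * gammaPDF 2 δ (x - δ) := by
        refine lintegral_mono fun x => ?_
        rcases lt_or_ge x δ with hx | hx
        · simp [ENNReal.ofReal_of_nonpos (sub_nonpos.2 hx.le)]
        · rw [gammaPDF_of_nonneg (sub_nonneg.2 hx), Pi.mul_apply, gaussianPDF,
            ← ENNReal.ofReal_mul (gaussianPDFReal_nonneg 0 1 x), ← ENNReal.ofReal_mul hC0]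
          refine ENNReal.ofReal_le_ofReal ?_
          have hg : Real.Gamma 2 = 1 := Real.Gamma_two
          have h1 : (x - δ) ^ ((2 : ℝ) - 1) = x - δ := by norm_num
          have h2 : δ ^ (2 : ℝ) = δ ^ 2 := by norm_num
          have hle : rexp (-x ^ 2 / 2) ≤ rexp (-δ ^ 2 / 2) * rexp (-(δ * (x - δ))) := by
            rw [← Real.exp_add, Real.exp_le_exp]
            nlinarith [sq_nonneg (x - δ)]
          have hx0 := sub_nonneg.2 hx
          calc gaussianPDFReal 0 1 x * (x - δ)
              = (√(2 * π))⁻¹ * (x - δ) * rexp (-x ^ 2 / 2) := by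
                simp [gaussianPDFReal]
                ring
            _ ≤ (√(2 * π))⁻¹ * (x - δ) * (rexp (-δ ^ 2 / 2) * rexp (-(δ * (x - δ)))) := by
                gcongr
            _ = _ := by
                rw [hg, h1, h2, hC]
                field_simp
    _ = ENNReal.ofReal C := by
        rw [lintegral_const_mul' _ _ ENNReal.ofReal_ne_top,
          lintegral_sub_right_eq_self (fun x => gammaPDF 2 δ x) δ,
          lintegral_gammaPDF_eq_one two_pos hδ, mul_one]

theorem lintegral_ofReal_abs_sub_gaussianReal_le {δ : ℝ} (hδ : 0 < δ) :
    ∫⁻ x, ENNReal.ofReal (|x| - δ) ∂(gaussianReal 0 1) ≤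
      2 * ENNReal.ofReal (1 / (δ ^ 2 * √(2 * π)) * rexp (-δ ^ 2 / 2)) := by
  have hneg : ∫⁻ x, ENNReal.ofReal (-x - δ) ∂(gaussianReal 0 1) =
      ∫⁻ x, ENNReal.ofReal (x - δ) ∂(gaussianReal 0 1) := by
    have hmap : (gaussianReal 0 1).map (fun x => -x) = gaussianReal 0 1 := by
      rw [gaussianReal_map_neg, neg_zero]
    conv_rhs => rw [← hmap, lintegral_map (by fun_prop) (by fun_prop)]
  calc ∫⁻ x, ENNReal.ofReal (|x| - δ) ∂(gaussianReal 0 1)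
      ≤ ∫⁻ x, ENNReal.ofReal (x - δ) + ENNReal.ofReal (-x - δ) ∂(gaussianReal 0 1) := by
        refine lintegral_mono fun x => ?_
        rcases abs_choice x with hx | hx <;> simp [hx]
    _ = ∫⁻ x, ENNReal.ofReal (x - δ) ∂(gaussianReal 0 1) +
          ∫⁻ x, ENNReal.ofReal (x - δ) ∂(gaussianReal 0 1) := by
        rw [lintegral_add_left (by fun_prop), hneg]
    _ ≤ _ := by
        rw [← two_mul]
        gcongr
        exact lintegral_ofReal_sub_gaussianReal_le hδ

/-- for `δ ≥ 2c`, `c ≥ 1`, points at distance at most 1 mismatch with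
probability at most `(1/(δ³√(2π))) e^{-δ²/2}`. -/
theorem tlsh_close_pair_mismatch_bound (d : ℕ) (hd : 1 ≤ d) (c δ : ℝ) (hc : 1 ≤ c)
    (hδ : 2 * c ≤ δ) (s q : Fin d → ℝ) (h : enorm' (s - q) ≤ 1) :
    PsiBar d δ s q ≤
      ENNReal.ofReal (1 / (δ ^ 3 * Real.sqrt (2 * π)) * Real.exp (-δ ^ 2 / 2)) := by
  have hδ0 : 0 < δ := by linarith
  have : SFinite (unifB δ) := by
    unfold unifB
    infer_instance
  have hsub (a : Fin d → ℝ) : dotp a s - dotp a q = dotp a (s - q) := by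
    simp only [dotp, ← Finset.sum_sub_distrib, Pi.sub_apply, mul_sub]
  have hinv : (ENNReal.ofReal (2 * δ))⁻¹ ≠ ∞ := by
    simpa using hδ0
  calc PsiBar d δ s q = ∫⁻ a, psiBar δ (dotp a s) (dotp a q) ∂(gaussPi d) :=
        Measure.prod_apply (measurableSet_setOf_mismatch δ s q)
    _ ≤ ∫⁻ a, (ENNReal.ofReal (2 * δ))⁻¹ * ENNReal.ofReal (|dotp a (s - q)| - δ)
          ∂(gaussPi d) := by
        refine lintegral_mono fun a => ?_
        rw [← hsub]
        exact psiBar_le hδ0 _ _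
    _ = (ENNReal.ofReal (2 * δ))⁻¹ *
          ∫⁻ x, ENNReal.ofReal (|enorm' (s - q) * x| - δ) ∂(gaussianReal 0 1) := by
        rw [lintegral_const_mul' _ _ hinv]
        congr 1
        have hf : Measurable fun y : ℝ => ENNReal.ofReal (|y| - δ) := by fun_prop
        rw [← lintegral_map hf (measurable_dotp_left (s - q)), gaussPi_map_dotp,
          lintegral_map hf (by fun_prop)]
    _ ≤ (ENNReal.ofReal (2 * δ))⁻¹ *
          ∫⁻ x, ENNReal.ofReal (|x| - δ) ∂(gaussianReal 0 1) := by
        gcongr (ENNReal.ofReal (2 * δ))⁻¹ * ?_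
        refine lintegral_mono fun x => ENNReal.ofReal_le_ofReal (sub_le_sub_right ?_ δ)
        rw [abs_mul, abs_of_nonneg (enorm'_nonneg (s - q))]
        exact mul_le_of_le_one_left (abs_nonneg x) h
    _ ≤ (ENNReal.ofReal (2 * δ))⁻¹ *
          (2 * ENNReal.ofReal (1 / (δ ^ 2 * √(2 * π)) * rexp (-δ ^ 2 / 2))) := by
        gcongr
        exact lintegral_ofReal_abs_sub_gaussianReal_le hδ0
    _ = _ := by
        rw [← ENNReal.ofReal_inv_of_pos (by positivity), ← ENNReal.ofReal_ofNat 2,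
          ← ENNReal.ofReal_mul (by positivity), ← ENNReal.ofReal_mul (by positivity)]
        congr 1
        field_simp

end
end

section
/- Let d ≥ 1, let c ≥ 1, let δ ≥ 2c, let n ≥ 1 be an integer, let ε > 0, and let w ≥ 1 be an integer satisfying (1 − (c³/(5δ³√(2π))) e^{−δ²/(2c²)})^w ≤ ε/n. Draw (a₁,b₁), …, (a_w,b_w) independently, each distributed as (a, b) with the d coordinates of a i.i.d. standard normal N(0,1) and b uniform on (0, 2δ). Let q ∈ ℝ^d and let S ⊆ ℝ^d be a finite set with |S| ≤ n such that ‖s − q‖ ≥ c for every s ∈ S. Then the expected number of points s ∈ S such that for every i ∈ {1, …, w} the ternary hashes of s and q under (a_i, b_i) match is at most ε. (The expected number of false positives is at most ε.) -/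
open MeasureTheory ProbabilityTheory Real
open scoped ENNReal

noncomputable section

lemma measurable_dotp {d : ℕ} (x : Fin d → ℝ) : Measurable fun a : Fin d → ℝ => dotp a x := by
  unfold dotp
  fun_prop

lemma measurable_jb (δ : ℝ) : Measurable fun p : ℝ × ℝ => jb δ p.1 p.2 := by
  have h : Measurable fun p : ℝ × ℝ => ⌊(p.2 + p.1) / δ⌋ := by fun_prop
  exact (measurable_of_countable fun n : ℤ => n % 4).comp h

lemma measurableSet_mismatch1 {α : Type*} [MeasurableSpace α] (δ : ℝ) {b u v : α → ℝ}
    (hb : Measurable b) (hu : Measurable u) (hv : Measurable v) :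
    MeasurableSet {x | Mismatch1 δ (b x) (u x) (v x)} := by
  have h1 : Measurable fun x => jb δ (b x) (u x) := (measurable_jb δ).comp (hb.prodMk hu)
  have h2 : Measurable fun x => jb δ (b x) (v x) := (measurable_jb δ).comp (hb.prodMk hv)
  have h (f : α → ℤ) (hf : Measurable f) (n : ℤ) : MeasurableSet {x | f x = n} :=
    hf (measurableSet_singleton n)
  exact ((h _ h1 0).inter (h _ h2 2)).union ((h _ h1 2).inter (h _ h2 0))

lemma isProbabilityMeasure_unifB {δ : ℝ} (hδ : 0 < δ) : IsProbabilityMeasure (unifB δ) := by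
  have h : ENNReal.ofReal (2 * δ) ≠ 0 := by simpa using hδ
  refine ⟨?_⟩
  rw [unifB, Measure.smul_apply, Measure.restrict_apply_univ, Real.volume_Ioo, sub_zero,
    smul_eq_mul, ENNReal.inv_mul_cancel h ENNReal.ofReal_ne_top]

/-- Inner products with a standard Gaussian vector are centred Gaussian. -/
lemma map_dotp_gaussPi {d : ℕ} (x : Fin d → ℝ) :
    (gaussPi d).map (fun a => dotp a x) = (gaussianReal 0 1).map (enorm' x * ·) := by
  have : IsProbabilityMeasure (gaussPi d) := by unfold gaussPi; infer_instance
  apply Measure.ext_of_charFun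
  ext t
  have hr : enorm' x ^ 2 = ∑ i, x i ^ 2 := Real.sq_sqrt (by positivity)
  rw [gaussianReal_map_const_mul, charFun_gaussianReal, charFun_apply_real,
    integral_map (measurable_dotp x).aemeasurable (by fun_prop)]
  have h1 (a : Fin d → ℝ) : Complex.exp (t * (dotp a x : ℝ) * Complex.I)
      = ∏ i, Complex.exp ((t * x i : ℝ) * (a i : ℝ) * Complex.I) := by
    rw [← Complex.exp_sum]
    congr 1
    simp only [dotp]
    push_cast
    rw [Finset.mul_sum, Finset.sum_mul]
    exact Finset.sum_congr rfl fun i _ => by ring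
  simp_rw [h1]
  rw [gaussPi, integral_fintype_prod_eq_prod
    (f := fun i (y : ℝ) => Complex.exp ((t * x i : ℝ) * (y : ℝ) * Complex.I))]
  simp_rw [← charFun_apply_real, charFun_gaussianReal]
  rw [← Complex.exp_sum]
  congr 1
  have hr' : ((enorm' x : ℝ) : ℂ) ^ 2 = ∑ i, (x i : ℂ) ^ 2 := by exact_mod_cast hr
  simp only [NNReal.coe_mul, NNReal.coe_mk, NNReal.coe_one]
  push_cast
  simp only [mul_zero, zero_mul, zero_sub, mul_one, one_mul, hr', Finset.sum_neg_distrib,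
    ← Finset.sum_div, mul_pow, ← Finset.mul_sum]
  ring

/-- The one-dimensional mismatch probability depends only on the difference of the points. -/
lemma psiBar_eq_psiBar_zero {δ : ℝ} (hδ : 0 < δ) (u v : ℝ) :
    psiBar δ u v = psiBar δ 0 (v - u) := by
  have hT : 0 < 2 * δ := by positivity
  set D : Set ℝ := {b | Mismatch1 δ b 0 (v - u)} with hD
  have hDm : MeasurableSet D :=
    measurableSet_mismatch1 δ measurable_id measurable_const measurable_const
  have hper (b : ℝ) : b + 2 * δ ∈ D ↔ b ∈ D := by
    have hj (z : ℝ) : jb δ (b + 2 * δ) z = (⌊(z + b) / δ⌋ + 2) % 4 := by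
      rw [jb, show (z + (b + 2 * δ)) / δ = (z + b) / δ + (2 : ℤ) by push_cast; field_simp; ring,
        Int.floor_add_intCast]
    simp only [hD, Set.mem_ofPred_eq, Mismatch1, hj]
    simp only [jb]
    omega
  have hper' : ∀ g : AddSubgroup.zmultiples (2 * δ), (fun b => g +ᵥ b) ⁻¹' D = D := by
    rintro ⟨_, n, rfl⟩
    ext b
    change n • (2 * δ) + b ∈ D ↔ b ∈ D
    rw [add_comm]
    have := Function.Periodic.zsmul (f := fun b => b ∈ D) (c := 2 * δ) (fun b => propext (hper b)) n b
    exact iff_of_eq this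
  have hunif (A : Set ℝ) (hA : MeasurableSet A) :
      unifB δ A = (ENNReal.ofReal (2 * δ))⁻¹ * volume (A ∩ Set.Ioc 0 (2 * δ)) := by
    rw [unifB, Measure.smul_apply, smul_eq_mul, Measure.restrict_congr_set Ioo_ae_eq_Ioc,
      Measure.restrict_apply hA]
  have hset : {b | Mismatch1 δ b u v} = (fun b => b + u) ⁻¹' D := by
    ext b
    simp only [hD, Set.mem_ofPred_eq, Set.mem_preimage, Mismatch1, jb]
    rw [show v - u + (b + u) = v + b by ring, show 0 + (b + u) = u + b by ring]
  rw [psiBar, psiBar, hset, hunif _ (hDm.preimage (by fun_prop)), ← hD, hunif _ hDm]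
  congr 1
  have h1 : (fun b => b + u) ⁻¹' D ∩ Set.Ioc 0 (2 * δ)
      = (fun b => b + u) ⁻¹' (D ∩ Set.Ioc u (u + 2 * δ)) := by
    ext b
    simp only [Set.mem_inter_iff, Set.mem_preimage, Set.mem_Ioc]
    constructor <;> rintro ⟨h1, h2, h3⟩ <;> exact ⟨h1, by linarith, by linarith⟩
  rw [h1, measure_preimage_add_right]
  have := (isAddFundamentalDomain_Ioc hT u).measure_set_eq (isAddFundamentalDomain_Ioc hT 0)
    hDm hper'
  simpa using this

lemma psiBar_comm (δ u v : ℝ) : psiBar δ u v = psiBar δ v u := by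
  unfold psiBar Mismatch1
  congr 1
  ext b
  simp only [Set.mem_ofPred_eq]
  tauto

lemma psiBar_zero_neg {δ : ℝ} (hδ : 0 < δ) (t : ℝ) : psiBar δ 0 (-t) = psiBar δ 0 t := by
  rw [psiBar_comm, psiBar_eq_psiBar_zero hδ]
  simp

lemma measurable_psiBar_zero {δ : ℝ} (hδ : 0 < δ) : Measurable fun t => psiBar δ 0 t := by
  have := isProbabilityMeasure_unifB hδ
  exact measurable_measure_prodMk_left
    (measurableSet_mismatch1 δ measurable_snd measurable_const measurable_fst)

/-- The mismatch probability of two points as a one-dimensional Gaussian average. -/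
lemma PsiBar_eq_lintegral {d : ℕ} {δ : ℝ} (hδ : 0 < δ) (s q : Fin d → ℝ) :
    PsiBar d δ s q = ∫⁻ t, psiBar δ 0 (enorm' (s - q) * t) ∂(gaussianReal 0 1) := by
  have := isProbabilityMeasure_unifB hδ
  have hm : MeasurableSet {ab : (Fin d → ℝ) × ℝ | Mismatch δ ab.1 ab.2 s q} :=
    measurableSet_mismatch1 δ measurable_snd ((measurable_dotp s).comp measurable_fst)
      ((measurable_dotp q).comp measurable_fst)
  have hdot (a : Fin d → ℝ) : dotp a q - dotp a s = -dotp a (s - q) := by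
    simp only [dotp, Pi.sub_apply, mul_sub, Finset.sum_sub_distrib]
    ring
  have h1 (a : Fin d → ℝ) : unifB δ (Prod.mk a ⁻¹' {ab | Mismatch δ ab.1 ab.2 s q})
      = psiBar δ 0 (dotp a (s - q)) := by
    rw [← psiBar_zero_neg hδ, ← hdot, ← psiBar_eq_psiBar_zero hδ]
    rfl
  rw [PsiBar, jointμ, Measure.prod_apply hm]
  simp_rw [h1]
  rw [← lintegral_map (f := fun t => psiBar δ 0 t) (measurable_psiBar_zero hδ)
    (measurable_dotp _), map_dotp_gaussPi,
    lintegral_map (measurable_psiBar_zero hδ) (by fun_prop)]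

lemma unifB_Ico {δ : ℝ} (hδ : 0 < δ) {x : ℝ} (hx : 0 ≤ x) :
    unifB δ (Set.Ico x δ) = ENNReal.ofReal ((1 - x / δ) / 2) := by
  rw [unifB, Measure.smul_apply, smul_eq_mul, Measure.restrict_congr_set Ioo_ae_eq_Ico,
    Measure.restrict_apply measurableSet_Ico, Set.inter_eq_left.2
      (Set.Ico_subset_Ico hx (by linarith)), Real.volume_Ico,
    ← ENNReal.ofReal_inv_of_pos (by positivity), ← ENNReal.ofReal_mul (by positivity)]
  congr 1
  field_simp

lemma le_psiBar_zero {δ : ℝ} (hδ : 0 < δ) {t : ℝ} (ht : t ≤ 2 * δ) :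
    ENNReal.ofReal ((t / δ - 1) / 2) ≤ psiBar δ 0 t := by
  have h := unifB_Ico hδ (x := 2 * δ - t) (by linarith)
  rw [show (1 - (2 * δ - t) / δ) / 2 = (t / δ - 1) / 2 by field_simp; ring] at h
  rw [← h]
  refine measure_mono fun b hb => Or.inl ⟨?_, ?_⟩
  · have : ⌊(0 + b) / δ⌋ = 0 := by
      rw [Int.floor_eq_iff, le_div_iff₀ hδ, div_lt_iff₀ hδ]
      push_cast
      constructor <;> linarith [hb.1, hb.2]
    simp only [jb, this]
    norm_num
  · have : ⌊(t + b) / δ⌋ = 2 := by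
      rw [Int.floor_eq_iff, le_div_iff₀ hδ, div_lt_iff₀ hδ]
      push_cast
      constructor <;> linarith [hb.1, hb.2]
    simp only [jb, this]
    norm_num

lemma half_le_sum_psiBar_zero {δ : ℝ} (hδ : 0 < δ) (t : ℝ) :
    ENNReal.ofReal (1 / 2) ≤ ∑ j ∈ Finset.range 4, psiBar δ 0 (t + j * δ) := by
  have h := unifB_Ico hδ le_rfl
  rw [zero_div, sub_zero] at h
  rw [← h]
  refine le_trans (measure_mono fun b hb => ?_) (measure_biUnion_finset_le (Finset.range 4) _)
  have h0 : ⌊(0 + b) / δ⌋ = 0 := by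
    rw [Int.floor_eq_iff, le_div_iff₀ hδ, div_lt_iff₀ hδ]
    push_cast
    constructor <;> linarith [hb.1, hb.2]
  have hj (j : ℕ) : ⌊(t + j * δ + b) / δ⌋ = ⌊(t + b) / δ⌋ + j := by
    rw [show (t + j * δ + b) / δ = (t + b) / δ + (j : ℤ) by push_cast; field_simp; ring,
      Int.floor_add_intCast]
  obtain ⟨j, hj4, hj2⟩ : ∃ j : ℕ, j < 4 ∧ (⌊(t + b) / δ⌋ + j) % 4 = 2 :=
    ⟨((2 - ⌊(t + b) / δ⌋) % 4).toNat, by omega, by omega⟩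
  simp only [Set.mem_iUnion, Finset.mem_range, Set.mem_ofPred_eq]
  exact ⟨j, hj4, Or.inl ⟨by simp only [jb, h0]; norm_num, by simp only [jb, hj, hj2]⟩⟩

lemma two_mul_setLIntegral_le_lintegral_gaussianReal {H : ℝ → ℝ≥0∞} (hH : Measurable H)
    (heven : ∀ t, H (-t) = H t) :
    2 * ∫⁻ t in Set.Ioi 0, gaussianPDF 0 1 t * H t ≤ ∫⁻ t, H t ∂(gaussianReal 0 1) := by
  have hG : Measurable fun t => gaussianPDF 0 1 t * H t := (measurable_gaussianPDF 0 1).mul hH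
  rw [gaussianReal_of_var_ne_zero 0 one_ne_zero,
    lintegral_withDensity_eq_lintegral_mul _ (measurable_gaussianPDF 0 1) hH]
  have hneg : ∫⁻ t in Set.Iio 0, gaussianPDF 0 1 t * H t
      = ∫⁻ t in Set.Ioi 0, gaussianPDF 0 1 t * H t := by
    rw [← (Measure.measurePreserving_neg (volume : Measure ℝ)).setLIntegral_comp_preimage
      measurableSet_Iio hG]
    have : (fun t : ℝ => -t) ⁻¹' Set.Iio 0 = Set.Ioi 0 := by ext; simp
    rw [show Neg.neg = fun t : ℝ => -t from rfl, this]
    refine lintegral_congr fun t => ?_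
    rw [heven]
    simp [gaussianPDF, gaussianPDFReal]
  have hdisj : Disjoint (Set.Iio (0 : ℝ)) (Set.Ioi 0) :=
    Set.disjoint_left.2 fun x hx hx' => lt_asymm (Set.mem_Iio.1 hx) (Set.mem_Ioi.1 hx')
  calc 2 * ∫⁻ t in Set.Ioi 0, gaussianPDF 0 1 t * H t
      = ∫⁻ t in Set.Iio 0 ∪ Set.Ioi 0, gaussianPDF 0 1 t * H t := by
        rw [lintegral_union measurableSet_Ioi hdisj, hneg, two_mul]
    _ ≤ _ := setLIntegral_le_lintegral _ _

lemma setLIntegral_comp_add_right_le {G : ℝ → ℝ≥0∞} (hG : Measurable G) {a : ℝ} (ha : 0 ≤ a)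
    (κ : ℝ) : ∫⁻ x in Set.Ioc 0 κ, G (x + a) ≤ ∫⁻ t in Set.Ioi 0, G t := by
  have h := (measurePreserving_add_right (volume : Measure ℝ) a).setLIntegral_comp_preimage
    (measurableSet_Ioc (a := a) (b := κ + a)) hG
  have : (fun x => x + a) ⁻¹' Set.Ioc a (κ + a) = Set.Ioc 0 κ := by ext; simp
  rw [this] at h
  rw [h]
  exact lintegral_mono_set fun x hx => ha.trans_lt hx.1

lemma integral_mul_exp_neg_mul {Y : ℝ} (hY : Y ≠ 0) (κ : ℝ) :
    ∫ x in (0 : ℝ)..κ, x * exp (-(x * Y))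
      = 1 / Y ^ 2 - (κ / Y + 1 / Y ^ 2) * exp (-(κ * Y)) := by
  have hderiv (x : ℝ) : HasDerivAt (fun x => -((x / Y + 1 / Y ^ 2) * exp (-(x * Y))))
      (x * exp (-(x * Y))) x := by
    have h1 : HasDerivAt (fun x => x / Y + 1 / Y ^ 2) (1 / Y) x :=
      ((hasDerivAt_id x).div_const Y).add_const _
    have h2 : HasDerivAt (fun x => exp (-(x * Y))) (exp (-(x * Y)) * (-(1 * Y))) x :=
      (((hasDerivAt_id x).mul_const Y).neg).exp
    refine (h1.mul h2).neg.congr_deriv ?_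
    field_simp
    ring
  rw [intervalIntegral.integral_eq_sub_of_hasDerivAt (fun x _ => hderiv x)
    (Continuous.intervalIntegrable (by fun_prop) _ _)]
  simp
  ring

lemma gaussianPDFReal_zero_one (t : ℝ) :
    gaussianPDFReal 0 1 t = (√(2 * π))⁻¹ * exp (-t ^ 2 / 2) := by
  simp [gaussianPDFReal]

lemma le_setLIntegral_gaussianPDF_of_wide {H : ℝ → ℝ≥0∞} (hH : Measurable H) {y Y : ℝ}
    (hY : 2 ≤ Y) (hy : 2 / 3 ≤ y) (hyY : y ≤ Y)
    (hle : ∀ t, y ≤ t → t ≤ 2 * y → ENNReal.ofReal ((t / y - 1) / 2) ≤ H t) :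
    ENNReal.ofReal ((√(2 * π))⁻¹ * exp (-Y ^ 2 / 2) / (10 * Y ^ 3))
      ≤ ∫⁻ t in Set.Ioi 0, gaussianPDF 0 1 t * H t := by
  have hG : Measurable fun t => gaussianPDF 0 1 t * H t := (measurable_gaussianPDF 0 1).mul hH
  have hy0 : 0 < y := by linarith
  have hY0 : 0 < Y := by linarith
  set κ : ℝ := 4 / 3 / Y with hκ
  have hκ0 : 0 ≤ κ := by positivity
  have hκ1 : κ ≤ 2 / 3 := by rw [hκ, div_le_iff₀ hY0]; linarith
  set K : ℝ := (√(2 * π))⁻¹ * exp (-Y ^ 2 / 2) * exp (-(2 / 9)) / (2 * Y) with hK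
  have hK0 : 0 ≤ K := by positivity
  refine le_trans ?_ (setLIntegral_comp_add_right_le hG hy0.le κ)
  have hint : ENNReal.ofReal (∫ x in Set.Ioc 0 κ, K * (x * exp (-(x * Y))))
      = ∫⁻ x in Set.Ioc 0 κ, ENNReal.ofReal (K * (x * exp (-(x * Y)))) := by
    refine ofReal_integral_eq_lintegral_ofReal
      (Continuous.integrableOn_Ioc (by fun_prop)) ?_
    filter_upwards [ae_restrict_mem measurableSet_Ioc] with x hx
    have := hx.1.le
    simp only [Pi.zero_apply]
    positivity
  calc ENNReal.ofReal ((√(2 * π))⁻¹ * exp (-Y ^ 2 / 2) / (10 * Y ^ 3))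
      ≤ ENNReal.ofReal (∫ x in Set.Ioc 0 κ, K * (x * exp (-(x * Y)))) := by
        apply ENNReal.ofReal_le_ofReal
        rw [← intervalIntegral.integral_of_le hκ0, intervalIntegral.integral_const_mul,
          integral_mul_exp_neg_mul hY0.ne']
        have h43 : κ * Y = 4 / 3 := by rw [hκ]; field_simp
        have he1 : exp (-(4 / 3)) ≤ 9 / 29 := by
          rw [exp_neg, inv_le_comm₀ (exp_pos _) (by norm_num)]
          have := quadratic_le_exp_of_nonneg (x := 4 / 3) (by norm_num)
          linarith
        have he2 : 7 / 9 ≤ exp (-(2 / 9)) := by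
          have := add_one_le_exp (-(2 / 9) : ℝ)
          linarith
        have he : 1 / 5 ≤ exp (-(2 / 9)) * (1 - 7 / 3 * exp (-(4 / 3))) := by
          nlinarith
        have hrw : K * (1 / Y ^ 2 - (κ / Y + 1 / Y ^ 2) * exp (-(κ * Y)))
            = (√(2 * π))⁻¹ * exp (-Y ^ 2 / 2) / (2 * Y ^ 3)
              * (exp (-(2 / 9)) * (1 - 7 / 3 * exp (-(4 / 3)))) := by
          rw [h43, hK, hκ]
          field_simp
          ring
        rw [hrw]
        calc (√(2 * π))⁻¹ * exp (-Y ^ 2 / 2) / (10 * Y ^ 3)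
            = (√(2 * π))⁻¹ * exp (-Y ^ 2 / 2) / (2 * Y ^ 3) * (1 / 5) := by
              field_simp
              norm_num
          _ ≤ _ := by gcongr
    _ = ∫⁻ x in Set.Ioc 0 κ, ENNReal.ofReal (K * (x * exp (-(x * Y)))) := hint
    _ ≤ ∫⁻ x in Set.Ioc 0 κ, gaussianPDF 0 1 (x + y) * H (x + y) := by
        refine setLIntegral_mono' measurableSet_Ioc fun x hx => ?_
        have hx0 := hx.1
        have hx1 := hx.2
        refine le_trans ?_ (mul_le_mul_right (hle (x + y) (by linarith) (by linarith)) _)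
        rw [gaussianPDF, gaussianPDFReal_zero_one, ← ENNReal.ofReal_mul (by positivity)]
        apply ENNReal.ofReal_le_ofReal
        have hexp : exp (-Y ^ 2 / 2) * exp (-(2 / 9)) * exp (-(x * Y))
            ≤ exp (-(x + y) ^ 2 / 2) := by
          rw [← exp_add, ← exp_add]
          apply exp_le_exp.2
          nlinarith
        have hlin : x / (2 * Y) ≤ ((x + y) / y - 1) / 2 := by
          rw [show ((x + y) / y - 1) / 2 = x / (2 * y) by field_simp; ring]
          gcongr
        calc K * (x * exp (-(x * Y)))
            = (√(2 * π))⁻¹ * (exp (-Y ^ 2 / 2) * exp (-(2 / 9)) * exp (-(x * Y)))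
              * (x / (2 * Y)) := by rw [hK]; ring
          _ ≤ _ := by gcongr

lemma le_setLIntegral_gaussianPDF_of_narrow {H : ℝ → ℝ≥0∞} (hH : Measurable H) {y Y : ℝ}
    (hY : 2 ≤ Y) (hy0 : 0 ≤ y) (hy : y ≤ 2 / 3)
    (hle : ∀ t, ENNReal.ofReal (1 / 2) ≤ ∑ j ∈ Finset.range 4, H (t + j * y)) :
    ENNReal.ofReal ((√(2 * π))⁻¹ * exp (-Y ^ 2 / 2) / (10 * Y ^ 3))
      ≤ ∫⁻ t in Set.Ioi 0, gaussianPDF 0 1 t * H t := by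
  have hG : Measurable fun t => gaussianPDF 0 1 t * H t := (measurable_gaussianPDF 0 1).mul hH
  set A := ∫⁻ t in Set.Ioi 0, gaussianPDF 0 1 t * H t with hA
  set m : ℝ := (√(2 * π))⁻¹ * exp (-(25 / 8)) with hm
  have hm0 : 0 ≤ m := by positivity
  have hwin (j : ℕ) (hj : j ∈ Finset.range 4) :
      ENNReal.ofReal m * ∫⁻ x in Set.Ioc (0 : ℝ) (1 / 2), H (x + j * y) ≤ A := by
    refine le_trans ?_ (setLIntegral_comp_add_right_le hG (a := j * y) (by positivity) (1 / 2))
    rw [← lintegral_const_mul _ (by fun_prop)]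
    refine setLIntegral_mono' measurableSet_Ioc fun x hx => ?_
    refine mul_le_mul_left ?_ _
    rw [gaussianPDF, gaussianPDFReal_zero_one]
    apply ENNReal.ofReal_le_ofReal
    have hj3 : (j : ℝ) ≤ 3 := by
      have := Finset.mem_range.1 hj
      exact_mod_cast (by omega : j ≤ 3)
    have hx0 := hx.1
    have hx1 := hx.2
    have hjy : (j : ℝ) * y ≤ 3 * (2 / 3) := by gcongr
    have hjy0 : 0 ≤ (j : ℝ) * y := by positivity
    rw [hm]
    gcongr
    nlinarith
  have hsum : ENNReal.ofReal (m / 4) ≤ 4 * A := by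
    calc ENNReal.ofReal (m / 4)
        = ENNReal.ofReal m * ∫⁻ _ in Set.Ioc (0 : ℝ) (1 / 2), ENNReal.ofReal (1 / 2) := by
          rw [setLIntegral_const, Real.volume_Ioc, ← ENNReal.ofReal_mul (by norm_num),
            ← ENNReal.ofReal_mul hm0]
          congr 1
          ring
      _ ≤ ENNReal.ofReal m * ∫⁻ x in Set.Ioc (0 : ℝ) (1 / 2),
            ∑ j ∈ Finset.range 4, H (x + j * y) := by
          gcongr with x
          exact hle x
      _ = ∑ j ∈ Finset.range 4,
            ENNReal.ofReal m * ∫⁻ x in Set.Ioc (0 : ℝ) (1 / 2), H (x + j * y) := by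
          rw [lintegral_finsetSum _ fun j _ => by fun_prop, Finset.mul_sum]
      _ ≤ ∑ j ∈ Finset.range 4, A := Finset.sum_le_sum hwin
      _ = 4 * A := by simp
  have hconst : (√(2 * π))⁻¹ * exp (-Y ^ 2 / 2) / (10 * Y ^ 3) ≤ m / 16 := by
    have hY3 : 8 ≤ Y ^ 3 := by
      calc (8 : ℝ) = 2 ^ 3 := by norm_num
        _ ≤ Y ^ 3 := by gcongr
    have he : exp (-Y ^ 2 / 2) ≤ exp (-2) := exp_le_exp.2 (by nlinarith)
    have he2 : 1 / 5 * exp (-2) ≤ exp (-(25 / 8)) := by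
      rw [show (-(25 / 8) : ℝ) = -1 + -(1 / 8) + -2 by norm_num, exp_add, exp_add]
      have h1 := exp_neg_one_gt_d9
      have h2 := add_one_le_exp (-(1 / 8) : ℝ)
      gcongr
      nlinarith
    calc (√(2 * π))⁻¹ * exp (-Y ^ 2 / 2) / (10 * Y ^ 3)
        ≤ (√(2 * π))⁻¹ * exp (-2) / (10 * 8) := by gcongr
      _ = (√(2 * π))⁻¹ * (1 / 5 * exp (-2)) / 16 := by ring
      _ ≤ m / 16 := by rw [hm]; gcongr
  refine (ENNReal.ofReal_le_ofReal hconst).trans ?_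
  have h4 : ENNReal.ofReal (m / 4) = 4 * ENNReal.ofReal (m / 16) := by
    rw [show m / 4 = 4 * (m / 16) by ring, ENNReal.ofReal_mul (by norm_num)]
    norm_num
  rw [h4] at hsum
  exact (ENNReal.mul_le_mul_iff_right (by norm_num) (by norm_num)).1 hsum

/-- Lower bound on the mismatch probability of points at distance at least `c`. -/
lemma le_PsiBar {d : ℕ} {c δ : ℝ} (hc : 0 < c) (hδ : 2 * c ≤ δ) {s q : Fin d → ℝ}
    (hfar : c ≤ enorm' (s - q)) :
    ENNReal.ofReal (c ^ 3 / (5 * δ ^ 3 * √(2 * π)) * exp (-δ ^ 2 / (2 * c ^ 2)))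
      ≤ PsiBar d δ s q := by
  have hδ0 : 0 < δ := by linarith
  set r := enorm' (s - q) with hr
  have hr0 : 0 < r := hc.trans_le hfar
  have hH : Measurable fun t => psiBar δ 0 (r * t) :=
    (measurable_psiBar_zero hδ0).comp (by fun_prop)
  have hY : 2 ≤ δ / c := by rwa [le_div_iff₀ hc]
  have hyY : δ / r ≤ δ / c := by gcongr
  rw [PsiBar_eq_lintegral hδ0]
  refine le_trans ?_ (two_mul_setLIntegral_le_lintegral_gaussianReal hH fun t => ?_)
  · have key : ENNReal.ofReal ((√(2 * π))⁻¹ * exp (-(δ / c) ^ 2 / 2) / (10 * (δ / c) ^ 3))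
        ≤ ∫⁻ t in Set.Ioi 0, gaussianPDF 0 1 t * psiBar δ 0 (r * t) := by
      rcases le_total (2 / 3) (δ / r) with hy | hy
      · refine le_setLIntegral_gaussianPDF_of_wide hH hY hy hyY fun t _ h2 => ?_
        rw [← mul_div_assoc, le_div_iff₀ hr0] at h2
        rw [show t / (δ / r) = r * t / δ by field_simp]
        exact le_psiBar_zero hδ0 (by linarith)
      · refine le_setLIntegral_gaussianPDF_of_narrow hH hY (by positivity) hy fun t => ?_
        have h (j : ℕ) : r * (t + j * (δ / r)) = r * t + j * δ := by field_simp
        simp_rw [h]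
        exact half_le_sum_psiBar_zero hδ0 (r * t)
    refine le_trans (le_of_eq ?_) (mul_le_mul_right key 2)
    rw [← ENNReal.ofReal_ofNat 2, ← ENNReal.ofReal_mul (by norm_num),
      show -δ ^ 2 / (2 * c ^ 2) = -(δ / c) ^ 2 / 2 by field_simp]
    congr 1
    field_simp
    norm_num
  · rw [mul_neg, psiBar_zero_neg hδ0]

/-- The probability that `w` independent hashes of a far point all match those of the query. -/
lemma pi_forall_not_mismatch_le {d : ℕ} {δ p : ℝ} (hδ : 0 < δ) (hp : 0 ≤ p)
    {s q : Fin d → ℝ} (h : ENNReal.ofReal p ≤ PsiBar d δ s q) (w : ℕ) :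
    (Measure.pi fun _ : Fin w => jointμ d δ) {ω | ∀ i, ¬ Mismatch δ (ω i).1 (ω i).2 s q}
      ≤ ENNReal.ofReal ((1 - p) ^ w) := by
  have := isProbabilityMeasure_unifB hδ
  have : IsProbabilityMeasure (gaussPi d) := by unfold gaussPi; infer_instance
  have : IsProbabilityMeasure (jointμ d δ) := by unfold jointμ; infer_instance
  set M : Set ((Fin d → ℝ) × ℝ) := {ab | Mismatch δ ab.1 ab.2 s q} with hM
  have hm : MeasurableSet M :=
    measurableSet_mismatch1 δ measurable_snd ((measurable_dotp s).comp measurable_fst)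
      ((measurable_dotp q).comp measurable_fst)
  have hp1 : p ≤ 1 := by
    have : ENNReal.ofReal p ≤ 1 := h.trans prob_le_one
    simpa using this
  have hset : {ω : Fin w → (Fin d → ℝ) × ℝ | ∀ i, ¬ Mismatch δ (ω i).1 (ω i).2 s q}
      = Set.univ.pi fun _ => Mᶜ := by
    ext ω
    simp [hM]
  rw [hset, Measure.pi_pi, Finset.prod_const, Finset.card_univ, Fintype.card_fin,
    ENNReal.ofReal_pow (by linarith), prob_compl_eq_one_sub hm, ENNReal.ofReal_sub _ hp,
    ENNReal.ofReal_one]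
  gcongr
  exact h

/-- with `w` independent hash draws,
`(1 - (c³/(5δ³√(2π))) e^{-δ²/(2c²)})^w ≤ ε/n`, the expected number of false positives
among at most `n` points all at distance at least `c` from the query is at most `ε`. -/
theorem expected_false_positives_le (d : ℕ) (hd : 1 ≤ d) (c δ : ℝ) (hc : 1 ≤ c)
    (hδ : 2 * c ≤ δ) (n : ℕ) (hn : 1 ≤ n) (ε : ℝ) (hε : 0 < ε) (w : ℕ) (hw : 1 ≤ w)
    (h : (1 - c ^ 3 / (5 * δ ^ 3 * Real.sqrt (2 * π)) * Real.exp (-δ ^ 2 / (2 * c ^ 2))) ^ w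
          ≤ ε / n)
    (q : Fin d → ℝ) (S : Finset (Fin d → ℝ)) (hS : S.card ≤ n)
    (hfar : ∀ s ∈ S, c ≤ enorm' (s - q)) :
    ∑ s ∈ S, (Measure.pi fun _ : Fin w => jointμ d δ)
        {ω | ∀ i, ¬ Mismatch δ (ω i).1 (ω i).2 s q} ≤ ENNReal.ofReal ε := by
  have hδ0 : 0 < δ := by linarith
  have hn0 : (0 : ℝ) < n := by exact_mod_cast hn
  calc ∑ s ∈ S, (Measure.pi fun _ : Fin w => jointμ d δ)
        {ω | ∀ i, ¬ Mismatch δ (ω i).1 (ω i).2 s q}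
      ≤ ∑ s ∈ S, ENNReal.ofReal (ε / n) := Finset.sum_le_sum fun s hs =>
        (pi_forall_not_mismatch_le hδ0 (by positivity)
          (le_PsiBar (by linarith) hδ (hfar s hs)) w).trans (ENNReal.ofReal_le_ofReal h)
    _ = S.card * ENNReal.ofReal (ε / n) := by rw [Finset.sum_const, nsmul_eq_mul]
    _ ≤ n * ENNReal.ofReal (ε / n) := by gcongr
    _ = ENNReal.ofReal ε := by
        rw [← ENNReal.ofReal_natCast, ← ENNReal.ofReal_mul hn0.le, mul_div_cancel₀ _ hn0.ne']

end
end
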